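/- For every nonzero integer k, the integral over [0, 2π] of e^{iky}·log(sin²(y/2)) dy equals −2π/|k|. -/

import Mathlib

open Real Complex

theorem integral_exp_I_mul_pow (j : ℕ) :
    ∫ y in (0:ℝ)..(2 * π), Complex.exp (Complex.I * y) ^ j = if j = 0 then 2 * (π : ℂ) else 0 := by
  split_ifs with hj
  · simp [hj]
  · have hc : (j : ℂ) * Complex.I ≠ 0 := by simp [hj]
    have hperiod : Complex.exp ((j : ℂ) * Complex.I * ((2 * π : ℝ) : ℂ)) = 1 :=
      Complex.exp_eq_one_iff.mpr ⟨j, by push_cast; ring⟩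
    calc ∫ y in (0:ℝ)..(2 * π), Complex.exp (Complex.I * y) ^ j
        = ∫ y in (0:ℝ)..(2 * π), Complex.exp ((j : ℂ) * Complex.I * y) := by
          congr 1 with y
          rw [← Complex.exp_nat_mul, mul_assoc]
      _ = 0 := by rw [integral_exp_mul_complex hc, hperiod]; simp

theorem integral_exp_I_add_one_mul_geom_sum {n : ℕ} (hn : n ≠ 0) :
    ∫ y in (0:ℝ)..(2 * π),
      (Complex.exp (Complex.I * y) + 1) * ∑ j ∈ Finset.range n, Complex.exp (Complex.I * y) ^ j
      = 2 * (π : ℂ) := by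
  have hint (j : ℕ) : IntervalIntegrable (fun y : ℝ => Complex.exp (Complex.I * y) ^ j)
      MeasureTheory.volume 0 (2 * π) := Continuous.intervalIntegrable (by fun_prop) _ _
  simp_rw [Finset.mul_sum, add_mul, one_mul, ← pow_succ']
  rw [intervalIntegral.integral_finsetSum fun j _ => (hint (j + 1)).add (hint j)]
  simp_rw [fun j => intervalIntegral.integral_add (hint (j + 1)) (hint j), integral_exp_I_mul_pow]
  simp [hn]

theorem exp_I_mul_sub_one (y : ℝ) :
    Complex.exp (Complex.I * y) - 1
      = 2 * Complex.I * Complex.exp (Complex.I * (y / 2)) * (Real.sin (y / 2) : ℂ) := by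
  have hsq : Complex.exp (Complex.I * y) = Complex.exp (Complex.I * (y / 2)) ^ 2 := by
    rw [← Complex.exp_nat_mul]; congr 1; push_cast; ring
  have hinv : Complex.exp (Complex.I * (y / 2)) * Complex.exp (-(y / 2) * Complex.I) = 1 := by
    rw [← Complex.exp_add]; ring_nf; exact Complex.exp_zero
  rw [hsq]
  push_cast
  rw [Complex.sin, mul_comm ((y : ℂ) / 2) Complex.I]
  linear_combination (-Complex.I ^ 2) * hinv +
    (Complex.exp (Complex.I * (y / 2)) ^ 2 - 1) * Complex.I_sq

theorem exp_I_mul_add_one (y : ℝ) :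
    Complex.exp (Complex.I * y) + 1
      = 2 * Complex.exp (Complex.I * (y / 2)) * (Real.cos (y / 2) : ℂ) := by
  have hsq : Complex.exp (Complex.I * y) = Complex.exp (Complex.I * (y / 2)) ^ 2 := by
    rw [← Complex.exp_nat_mul]; congr 1; push_cast; ring
  have hinv : Complex.exp (Complex.I * (y / 2)) * Complex.exp (-(y / 2) * Complex.I) = 1 := by
    rw [← Complex.exp_add]; ring_nf; exact Complex.exp_zero
  rw [hsq]
  push_cast
  rw [Complex.cos, mul_comm ((y : ℂ) / 2) Complex.I]
  linear_combination -hinv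

theorem continuous_exp_I_pow_sub_one_mul_log_sin_sq (n : ℕ) :
    Continuous fun y : ℝ => (Complex.exp (Complex.I * y) ^ n - 1)
      * ((Real.log (Real.sin (y / 2) ^ 2) : ℝ) : ℂ) := by
  have hcont : Continuous fun y : ℝ => Real.sin (y / 2) * Real.log (Real.sin (y / 2)) :=
    Real.continuous_mul_log.comp (by fun_prop)
  have heq : (fun y : ℝ => (Complex.exp (Complex.I * y) ^ n - 1)
      * ((Real.log (Real.sin (y / 2) ^ 2) : ℝ) : ℂ)) =
      fun y : ℝ => (∑ j ∈ Finset.range n, Complex.exp (Complex.I * y) ^ j) *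
        (4 * Complex.I * Complex.exp (Complex.I * (y / 2))) *
        ((Real.sin (y / 2) * Real.log (Real.sin (y / 2)) : ℝ) : ℂ) := by
    ext y
    rw [← geom_sum_mul, exp_I_mul_sub_one, Real.log_pow]
    push_cast
    ring
  rw [heq]
  fun_prop

theorem hasDerivAt_log_sin_half_sq {y : ℝ} (hy : Real.sin (y / 2) ≠ 0) :
    HasDerivAt (fun y : ℝ => Real.log (Real.sin (y / 2) ^ 2))
      (Real.cos (y / 2) / Real.sin (y / 2)) y := by
  have h := ((((hasDerivAt_id y).div_const 2).sin).pow 2).log (pow_ne_zero 2 hy)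
  refine h.congr_deriv ?_
  simp only [id, Pi.pow_apply]
  field_simp
  norm_num
  ring

theorem hasDerivAt_exp_I_pow_sub_one_mul_log_sin_sq (n : ℕ) {y : ℝ} (hy : Real.sin (y / 2) ≠ 0) :
    HasDerivAt (fun y : ℝ => (Complex.exp (Complex.I * y) ^ n - 1)
        * ((Real.log (Real.sin (y / 2) ^ 2) : ℝ) : ℂ))
      (Complex.I * n * (Complex.exp (Complex.I * y) ^ n
          * ((Real.log (Real.sin (y / 2) ^ 2) : ℝ) : ℂ))
        + Complex.I * ((Complex.exp (Complex.I * y) + 1)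
          * ∑ j ∈ Finset.range n, Complex.exp (Complex.I * y) ^ j)) y := by
  have hexp (t : ℝ) : Complex.exp (Complex.I * t) ^ n = Complex.exp (n * Complex.I * t) := by
    rw [← Complex.exp_nat_mul, mul_assoc]
  have hpow : HasDerivAt (fun y : ℝ => Complex.exp (Complex.I * y) ^ n - 1)
      (Complex.I * n * Complex.exp (Complex.I * y) ^ n) y := by
    simp_rw [hexp]
    refine (((hasDerivAt_id y).ofReal_comp.const_mul (n * Complex.I)).cexp.sub_const 1).congr_deriv ?_
    simp only [id, Complex.ofReal_one]
    ring
  refine (hpow.mul (hasDerivAt_log_sin_half_sq hy).ofReal_comp).congr_deriv ?_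
  have hy' : (Real.sin (y / 2) : ℂ) ≠ 0 := Complex.ofReal_ne_zero.mpr hy
  rw [← geom_sum_mul, exp_I_mul_sub_one, exp_I_mul_add_one, Complex.ofReal_div]
  field_simp

theorem intervalIntegrable_log_sin_half_sq (a b : ℝ) :
    IntervalIntegrable (fun y : ℝ => Real.log (Real.sin (y / 2) ^ 2))
      MeasureTheory.volume a b := by
  simp_rw [Real.log_pow]
  have h : IntervalIntegrable (Real.log ∘ Real.sin) MeasureTheory.volume (a / 2) (b / 2) :=
    intervalIntegrable_log_sin
  have h' := (h.comp_mul_right (c := 1 / 2)).const_mul ((2 : ℕ) : ℝ)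
  simpa [div_eq_mul_inv] using h'

theorem integral_exp_I_pow_mul_log_sin_sq {n : ℕ} (hn : n ≠ 0) :
    ∫ y in (0:ℝ)..(2 * π),
      Complex.exp (Complex.I * y) ^ n * ((Real.log (Real.sin (y / 2) ^ 2) : ℝ) : ℂ)
      = -(2 * π) / n := by
  have hlog : IntervalIntegrable (fun y : ℝ => Complex.exp (Complex.I * y) ^ n
      * ((Real.log (Real.sin (y / 2) ^ 2) : ℝ) : ℂ)) MeasureTheory.volume 0 (2 * π) :=
    have h := intervalIntegrable_log_sin_half_sq 0 (2 * π)
    IntervalIntegrable.continuousOn_mul ⟨h.1.ofReal, h.2.ofReal⟩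
      (Continuous.continuousOn (by fun_prop))
  have hgeom : IntervalIntegrable (fun y : ℝ => (Complex.exp (Complex.I * y) + 1)
      * ∑ j ∈ Finset.range n, Complex.exp (Complex.I * y) ^ j) MeasureTheory.volume 0 (2 * π) :=
    Continuous.intervalIntegrable (by fun_prop) _ _
  have hftc := intervalIntegral.integral_eq_sub_of_hasDerivAt_of_le
    Real.two_pi_pos.le (continuous_exp_I_pow_sub_one_mul_log_sin_sq n).continuousOn
    (fun y hy => hasDerivAt_exp_I_pow_sub_one_mul_log_sin_sq n
      (Real.sin_pos_of_pos_of_lt_pi (by linarith [hy.1]) (by linarith [hy.2])).ne')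
    ((hlog.const_mul (Complex.I * n)).add (hgeom.const_mul Complex.I))
  rw [intervalIntegral.integral_add (hlog.const_mul _) (hgeom.const_mul _),
    intervalIntegral.integral_const_mul, intervalIntegral.integral_const_mul,
    integral_exp_I_add_one_mul_geom_sum hn] at hftc
  have hn' : (n : ℂ) ≠ 0 := Nat.cast_ne_zero.mpr hn
  have hends : ∀ c : ℂ, Complex.I * n * c + Complex.I * (2 * π) = 0 → c = -(2 * π) / n := by
    intro c hc
    rw [eq_div_iff hn']
    refine mul_left_cancel₀ Complex.I_ne_zero ?_
    linear_combination hc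
  refine hends _ (hftc.trans ?_)
  simp

theorem integral_exp_log_sin_sq (k : ℤ) (hk : k ≠ 0) :
    ∫ y in (0:ℝ)..(2 * π),
      Complex.exp (Complex.I * k * y) * ((Real.log (Real.sin (y / 2) ^ 2) : ℝ) : ℂ)
      = ((-(2 * π) / (k.natAbs : ℝ) : ℝ) : ℂ) := by
  have hnat : ((-(2 * π) / (k.natAbs : ℝ) : ℝ) : ℂ) = -(2 * π) / (k.natAbs : ℂ) := by
    push_cast; rfl
  rw [hnat, ← integral_exp_I_pow_mul_log_sin_sq (Int.natAbs_ne_zero.mpr hk)]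
  have hexp (y : ℝ) :
      Complex.exp (Complex.I * y) ^ k.natAbs = Complex.exp (Complex.I * (k.natAbs : ℤ) * y) := by
    rw [← Complex.exp_nat_mul, Int.cast_natCast]; congr 1; ring
  simp_rw [hexp]
  rcases Int.natAbs_eq k with h | h
  · rw [← h]
  · have hneg : ((k.natAbs : ℤ)) = -k := by omega
    rw [hneg]
    have hsub := intervalIntegral.integral_comp_sub_left (a := 0) (b := 2 * π)
      (fun y : ℝ => Complex.exp (Complex.I * k * y)
        * ((Real.log (Real.sin (y / 2) ^ 2) : ℝ) : ℂ)) (2 * π)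
    rw [sub_self, sub_zero] at hsub
    rw [← hsub]
    congr 1 with y
    have hsin : Real.sin ((2 * π - y) / 2) = Real.sin (y / 2) := by
      rw [← Real.sin_pi_sub]; congr 1; ring
    have hper : Complex.exp (Complex.I * k * ((2 * π - y : ℝ) : ℂ))
        = Complex.exp (Complex.I * ((-k : ℤ) : ℂ) * y) :=
      Complex.exp_eq_exp_iff_exists_int.mpr ⟨k, by push_cast; ring⟩
    rw [hsin, hper]
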